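/- Let ψ be a reduced admissible function. Then δ(ψ) < 2 if and only if there exists an integer B such that for all sufficiently large i, ψ(i) ∈ ℕ* and ψ(i) ≥ i − B. -/

import Mathlib

open Filter

/-- The prefix of length `n` of the infinite word `w`. -/
def pref {A : Type*} (w : ℕ → A) (n : ℕ) : List A := (List.range n).map w

/-- The predicate "the prefix of `w` of length `n` is a palindrome". -/
def palP {A : Type*} (w : ℕ → A) : ℕ → Prop := fun n => (pref w n).Palindrome

/-- An admissible function: index `i : ℕ` stands for the paper's index `i + 1`, and the
value `Sum.inr j` stands for the paper's integer value `j + 1`; so the paper's condition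
`1 ≤ ψ(n) ≤ n - 1` becomes `j < i`. -/
def Admissible {A : Type*} (ψ : ℕ → A ⊕ ℕ) : Prop :=
  ∀ i j, ψ i = Sum.inr j → j < i

/-- The set `S(ψ)` of indices `n` with `ψ(n) ∈ A` or `ψ(n) ≤ n - 2` (in the paper's
indexing; here `i` stands for `n = i + 1` and `Sum.inr j` for the value `j + 1`). -/
def Sset {A : Type*} (ψ : ℕ → A ⊕ ℕ) : Set ℕ :=
  {i | (∃ a, ψ i = Sum.inl a) ∨ ∃ j, ψ i = Sum.inr j ∧ j + 2 ≤ i}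

/-- `m < n` are consecutive elements of `S`. -/
def ConsecIn (S : Set ℕ) (m n : ℕ) : Prop :=
  m ∈ S ∧ n ∈ S ∧ m < n ∧ ∀ k ∈ S, ¬(m < k ∧ k < n)

/-- `ψ` is reduced: for consecutive `m < n` in `S(ψ)`, `ψ(n) ≠ ψ(m)` and either
`ψ(n) ∈ A` or `ψ(n) < m` (in the paper's indexing: `Sum.inr j` stands for the value
`j + 1` and `m` for the index `m + 1`, so the paper's `ψ(n) < m` becomes `j < m`). -/
def Reduced {A : Type*} (ψ : ℕ → A ⊕ ℕ) : Prop :=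
  ∀ m n, ConsecIn (Sset ψ) m n →
    ψ n ≠ ψ m ∧ ((∃ a, ψ n = Sum.inl a) ∨ ∃ j, ψ n = Sum.inr j ∧ j < m)

/-- The palindromes `π_i` associated with `ψ` (`piW ψ i` is the paper's `π_{i+1}`):
`π_1 = ε`; `π_{i+1} = π_i a π_i` if `ψ(i) = a ∈ A`, and `π_{i+1} = π_i u` where `u` is
`π_i` with its first `|π_j|` letters deleted if `ψ(i) = j ∈ ℕ*`. (The `min j i` is
irrelevant when `ψ` is admissible, since then `j < i`.) -/
def piW {A : Type*} (ψ : ℕ → A ⊕ ℕ) : ℕ → List A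
  | 0 => []
  | (i + 1) =>
    match ψ i with
    | Sum.inl a => piW ψ i ++ a :: piW ψ i
    | Sum.inr j => piW ψ i ++ (piW ψ i).drop (piW ψ (min j i)).length

/-- The sequence `(n_i)` associated with `ψ` (`nseq ψ i` is the paper's `n_{i+1}`). -/
def nseq {A : Type*} (ψ : ℕ → A ⊕ ℕ) : ℕ → ℕ
  | 0 => 0
  | (i + 1) =>
    match ψ i with
    | Sum.inl _ => 2 * nseq ψ i + 1
    | Sum.inr j => 2 * nseq ψ i - nseq ψ (min j i)

/-- `δ(ψ) = limsup n_{i+1} / n_i`. -/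
noncomputable def deltaPsi {A : Type*} (ψ : ℕ → A ⊕ ℕ) : ENNReal :=
  limsup (fun i => (nseq ψ (i + 1) : ENNReal) / (nseq ψ i : ENNReal)) atTop

section helpers
variable {A : Type*} {ψ : ℕ → A ⊕ ℕ}

lemma nseq_inl {i : ℕ} {a : A} (h : ψ i = Sum.inl a) : nseq ψ (i + 1) = 2 * nseq ψ i + 1 := by
  rw [nseq, h]

lemma nseq_inr' {i j : ℕ} (h : ψ i = Sum.inr j) :
    nseq ψ (i + 1) = 2 * nseq ψ i - nseq ψ (min j i) := by
  rw [nseq, h]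

lemma nseq_lt (hadm : Admissible ψ) : ∀ i, ∀ k < i, nseq ψ k < nseq ψ i := by
  intro i
  induction i with
  | zero => intro k hk; omega
  | succ i ih =>
    have key : nseq ψ i < nseq ψ (i + 1) := by
      cases h : ψ i with
      | inl a => rw [nseq_inl h]; omega
      | inr j =>
        have hj := hadm i j h
        rw [nseq_inr' h, min_eq_left hj.le]
        have := ih j hj
        omega
    intro k hk
    rcases Nat.lt_succ_iff_lt_or_eq.mp hk with h | h
    · exact (ih k h).trans key
    · rw [h]; exact key

lemma nseq_le (hadm : Admissible ψ) {k i : ℕ} (h : k ≤ i) : nseq ψ k ≤ nseq ψ i := by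
  rcases h.lt_or_eq with h | h
  · exact (nseq_lt hadm i k h).le
  · rw [h]

lemma nseq_inr (hadm : Admissible ψ) {i j : ℕ} (h : ψ i = Sum.inr j) :
    nseq ψ (i + 1) + nseq ψ j = 2 * nseq ψ i := by
  have hj := hadm i j h
  rw [nseq_inr' h, min_eq_left hj.le]
  have := nseq_lt hadm i j hj
  omega

lemma zero_mem (hadm : Admissible ψ) : 0 ∈ Sset ψ := by
  left
  cases h : ψ 0 with
  | inl a => exact ⟨a, rfl⟩
  | inr j => exact absurd (hadm 0 j h) (by omega)

lemma exists_pred (hadm : Admissible ψ) {i : ℕ} (hi : i ∈ Sset ψ) (h0 : 0 < i) :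
    ∃ m, ConsecIn (Sset ψ) m i := by
  classical
  have h1 : Nat.findGreatest (· ∈ Sset ψ) (i - 1) ∈ Sset ψ :=
    Nat.findGreatest_spec (P := (· ∈ Sset ψ)) (Nat.zero_le _) (zero_mem hadm)
  have h2 := Nat.findGreatest_le (P := (· ∈ Sset ψ)) (i - 1)
  refine ⟨_, h1, hi, by omega, ?_⟩
  rintro k hk ⟨hk1, hk2⟩
  exact Nat.findGreatest_is_greatest hk1 (by omega) hk

lemma notS (hadm : Admissible ψ) {i : ℕ} (hi : i ∉ Sset ψ) :
    ∃ j, ψ i = Sum.inr j ∧ i = j + 1 := by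
  cases h : ψ i with
  | inl a => exact absurd (Or.inl ⟨a, h⟩) hi
  | inr j =>
    refine ⟨j, rfl, ?_⟩
    have := hadm i j h
    by_contra hc
    exact hi (Or.inr ⟨j, h, by omega⟩)

lemma gap (hadm : Admissible ψ) {m n : ℕ} (hc : ConsecIn (Sset ψ) m n) :
    ∀ t, m + t < n → nseq ψ (m + t + 1) + nseq ψ m = nseq ψ (m + t) + nseq ψ (m + 1) := by
  intro t
  induction t with
  | zero => intro _; simp; omega
  | succ t ih =>
    intro ht
    have ih := ih (by omega)
    have hn : m + (t + 1) ∉ Sset ψ := fun h => hc.2.2.2 _ h ⟨by omega, by omega⟩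
    obtain ⟨j, hj, hj2⟩ := notS hadm hn
    have h3 : j = m + t := by omega
    subst h3
    have := nseq_inr hadm hj
    rw [← add_assoc] at this ⊢
    omega

lemma gap_sum (hadm : Admissible ψ) {m n : ℕ} (hc : ConsecIn (Sset ψ) m n) :
    ∀ t, m + t ≤ n → nseq ψ (m + t) + t * nseq ψ m = nseq ψ m + t * nseq ψ (m + 1) := by
  intro t
  induction t with
  | zero => intro _; simp
  | succ t ih =>
    intro ht
    have ih := ih (by omega)
    have := gap hadm hc t (by omega)
    rw [← add_assoc]
    linarith

lemma keyS (hadm : Admissible ψ) (hred : Reduced ψ) :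
    ∀ m, m ∈ Sset ψ → ∀ j, ψ m = Sum.inr j → nseq ψ j + nseq ψ (m - 1) ≤ nseq ψ m := by
  intro m
  induction m using Nat.strong_induction_on with
  | _ m ih =>
    intro hm j hj
    have hjm := hadm m j hj
    obtain ⟨p, hp⟩ := exists_pred hadm hm (by omega)
    have hpm := hp.2.2.1
    have hjp : j < p := by
      rcases (hred p m hp).2 with ⟨a, ha⟩ | ⟨j', hj', hlt⟩
      · rw [hj] at ha; cases ha
      · rw [hj] at hj'; cases hj'; exact hlt
    have hg := gap hadm hp (m - 1 - p) (by omega)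
    rw [show p + (m - 1 - p) = m - 1 by omega, show m - 1 + 1 = m by omega] at hg
    have h1 : nseq ψ j ≤ nseq ψ (p - 1) := nseq_le hadm (by omega)
    have h2 : nseq ψ (p - 1) ≤ nseq ψ p := nseq_le hadm (by omega)
    cases h : ψ p with
    | inl a => have := nseq_inl h; omega
    | inr j' =>
      have := nseq_inr hadm h
      have := ih p hpm hp.1 j' h
      omega

lemma growS (hadm : Admissible ψ) (hred : Reduced ψ) {m : ℕ} (hm : m ∈ Sset ψ) :
    3 * nseq ψ m ≤ 2 * nseq ψ (m + 1) := by
  cases h : ψ m with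
  | inl a => have := nseq_inl h; omega
  | inr j =>
    have := nseq_inr hadm h
    have := keyS hadm hred m hm j h
    have := hadm m j h
    have : nseq ψ j ≤ nseq ψ (m - 1) := nseq_le hadm (by omega)
    omega

lemma stepS (hadm : Admissible ψ) (hred : Reduced ψ) {C N : ℕ}
    (H : ∀ i ≥ N, ∃ j, ψ i = Sum.inr j ∧ nseq ψ i ≤ C * nseq ψ j) {i : ℕ} (hi : i ∈ Sset ψ)
    (h0 : 0 < i) (hN : N ≤ i) :
    ∃ m ∈ Sset ψ, i ≤ m + 2 * C ∧ 3 * nseq ψ m ≤ 2 * nseq ψ i := by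
  obtain ⟨p, hp⟩ := exists_pred hadm hi h0
  obtain ⟨j, hj, hC⟩ := H i hN
  have hpm := hp.2.2.1
  have hjp : j < p := by
    rcases (hred p i hp).2 with ⟨a, ha⟩ | ⟨j', hj', hlt⟩
    · rw [hj] at ha; cases ha
    · rw [hj] at hj'; cases hj'; exact hlt
  have hg := growS hadm hred hp.1
  have hl : nseq ψ (p + 1) ≤ nseq ψ i := nseq_le hadm (by omega)
  refine ⟨p, hp.1, ?_, by omega⟩
  have hs := gap_sum hadm hp (i - p) (by omega)
  rw [show p + (i - p) = i by omega] at hs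
  have hjlt := nseq_lt hadm p j hjp
  have h1 : nseq ψ i ≤ C * nseq ψ p := hC.trans (Nat.mul_le_mul_left _ hjlt.le)
  by_contra hcon
  obtain ⟨t, ht⟩ : ∃ t, t = i - p := ⟨_, rfl⟩
  rw [← ht] at hs
  have h2 : t * (3 * nseq ψ p) ≤ t * (2 * nseq ψ (p + 1)) := Nat.mul_le_mul_left _ hg
  have h3 : (2 * C) * nseq ψ p ≤ t * nseq ψ p := Nat.mul_le_mul_right _ (by omega)
  nlinarith

lemma iterS (hadm : Admissible ψ) (hred : Reduced ψ) {C N : ℕ}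
    (H : ∀ i ≥ N, ∃ j, ψ i = Sum.inr j ∧ nseq ψ i ≤ C * nseq ψ j) (K : ℕ) :
    ∀ i ∈ Sset ψ, N + 1 + K * (2 * C) ≤ i →
    ∃ m ∈ Sset ψ, i ≤ m + K * (2 * C) ∧ 3 ^ K * nseq ψ m ≤ 2 ^ K * nseq ψ i := by
  induction K with
  | zero => intro i hi _; exact ⟨i, hi, by omega, by simp⟩
  | succ K ih =>
    intro i hi hN
    rw [Nat.succ_mul] at hN
    obtain ⟨p, hp, h1, h2⟩ := stepS hadm hred H hi (by omega) (by omega)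
    obtain ⟨m, hm, h3, h4⟩ := ih p hp (by omega)
    refine ⟨m, hm, by rw [Nat.succ_mul]; omega, ?_⟩
    calc 3 ^ (K + 1) * nseq ψ m = 3 * (3 ^ K * nseq ψ m) := by ring
      _ ≤ 3 * (2 ^ K * nseq ψ p) := Nat.mul_le_mul_left _ h4
      _ = 2 ^ K * (3 * nseq ψ p) := by ring
      _ ≤ 2 ^ K * (2 * nseq ψ i) := Nat.mul_le_mul_left _ h2
      _ = _ := by ring

lemma exists_K (C : ℕ) : ∃ K : ℕ, C * 2 ^ K ≤ 3 ^ K := by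
  obtain ⟨K, hK⟩ := pow_unbounded_of_one_lt (C : ℝ) (show (1 : ℝ) < 3 / 2 by norm_num)
  refine ⟨K, ?_⟩
  rw [div_pow, lt_div_iff₀ (by positivity)] at hK
  exact_mod_cast hK.le

lemma fwd (hadm : Admissible ψ) (hred : Reduced ψ) {C N : ℕ}
    (H : ∀ i ≥ N, ∃ j, ψ i = Sum.inr j ∧ nseq ψ i ≤ C * nseq ψ j) :
    ∃ B : ℕ, ∃ N : ℕ, ∀ i ≥ N, ∃ j : ℕ, ψ i = Sum.inr j ∧ i ≤ j + B := by
  obtain ⟨K, hK⟩ := exists_K C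
  refine ⟨K * (2 * C) + 1, N + 1 + K * (2 * C), fun i hi => ?_⟩
  by_cases hS : i ∈ Sset ψ
  · obtain ⟨j, hj, hC⟩ := H i (by omega)
    refine ⟨j, hj, ?_⟩
    obtain ⟨m, hm, h1, h2⟩ := iterS hadm hred H K i hS hi
    by_contra hcon
    have h3 := nseq_lt hadm m j (by omega)
    have h4 : 3 ^ K * nseq ψ m ≤ 3 ^ K * nseq ψ j := by
      calc _ ≤ 2 ^ K * nseq ψ i := h2
        _ ≤ 2 ^ K * (C * nseq ψ j) := Nat.mul_le_mul_left _ hC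
        _ = (C * 2 ^ K) * nseq ψ j := by ring
        _ ≤ _ := Nat.mul_le_mul_right _ hK
    have := Nat.le_of_mul_le_mul_left h4 (by positivity)
    omega
  · obtain ⟨j, hj, h⟩ := notS hadm hS
    exact ⟨j, hj, by omega⟩

lemma nseq_pos (hadm : Admissible ψ) {i : ℕ} (h : 0 < i) : 0 < nseq ψ i :=
  lt_of_le_of_lt (Nat.zero_le _) (nseq_lt hadm i 0 h)

lemma nseq_succ_le (hadm : Admissible ψ) {i : ℕ} (h : 0 < i) :
    nseq ψ (i + 1) ≤ 3 * nseq ψ i := by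
  have := nseq_pos hadm h
  cases h : ψ i with
  | inl a => have := nseq_inl h; omega
  | inr j => have := nseq_inr hadm h; omega

lemma nseq_add_le (hadm : Admissible ψ) {i : ℕ} (h : 0 < i) (t : ℕ) :
    nseq ψ (i + t) ≤ 3 ^ t * nseq ψ i := by
  induction t with
  | zero => simp
  | succ t ih =>
    have := nseq_succ_le hadm (i := i + t) (by omega)
    rw [← add_assoc, pow_succ]
    linarith

lemma ratio_eq (hadm : Admissible ψ) {i : ℕ} (h : 0 < i) :
    (nseq ψ (i + 1) : ENNReal) / (nseq ψ i : ENNReal)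
      = ENNReal.ofReal ((nseq ψ (i + 1) : ℝ) / (nseq ψ i : ℝ)) := by
  rw [ENNReal.ofReal_div_of_pos (by exact_mod_cast nseq_pos hadm h)]
  simp

end helpers

theorem stmt17 {A : Type*} (ψ : ℕ → A ⊕ ℕ) (hadm : Admissible ψ) (hred : Reduced ψ) :
    deltaPsi ψ < 2 ↔
      ∃ B : ℕ, ∃ N : ℕ, ∀ i ≥ N, ∃ j : ℕ, ψ i = Sum.inr j ∧ i ≤ j + B := by
  constructor
  · intro h
    obtain ⟨c, hc1, hc2⟩ := exists_between h
    have hev := eventually_lt_of_limsup_lt hc1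
    obtain ⟨N, hN⟩ := eventually_atTop.mp hev
    lift c to NNReal using (hc2.trans (by simp)).ne
    have hc3 : (c : ℝ) < 2 := by exact_mod_cast hc2
    obtain ⟨C, hC⟩ := exists_nat_gt (1 / (2 - (c : ℝ)))
    have h2c : 0 < 2 - (c : ℝ) := by linarith
    rw [div_lt_iff₀ h2c] at hC
    apply fwd hadm hred (C := C) (N := N + 1)
    intro i hi
    have h1 := hN i (by omega)
    have hpos : (0 : ℝ) < nseq ψ i := by exact_mod_cast nseq_pos hadm (by omega)
    rw [ratio_eq hadm (by omega), ← ENNReal.ofReal_coe_nnreal,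
      ENNReal.ofReal_lt_ofReal_iff_of_nonneg (by positivity), div_lt_iff₀ hpos] at h1
    cases h : ψ i with
    | inl a =>
      exfalso
      rw [nseq_inl h] at h1
      push_cast at h1
      nlinarith
    | inr j =>
      refine ⟨j, rfl, ?_⟩
      have h3 : (nseq ψ (i + 1) : ℝ) + nseq ψ j = 2 * nseq ψ i := by
        exact_mod_cast nseq_inr hadm h
      have h4 : (2 - (c : ℝ)) * nseq ψ i ≤ nseq ψ j := by linarith
      have h5 : (nseq ψ i : ℝ) ≤ C * nseq ψ j := by
        calc (nseq ψ i : ℝ) = 1 * nseq ψ i := by ring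
          _ ≤ (C * (2 - (c : ℝ))) * nseq ψ i := by gcongr
          _ = C * ((2 - (c : ℝ)) * nseq ψ i) := by ring
          _ ≤ _ := by gcongr
      exact_mod_cast h5
  · rintro ⟨B, N, H⟩
    have hle : deltaPsi ψ ≤ ENNReal.ofReal (2 - 1 / 3 ^ B) := by
      apply limsup_le_of_le (by isBoundedDefault)
      rw [eventually_atTop]
      refine ⟨N + B + 1, fun i hi => ?_⟩
      obtain ⟨j, hj, hB⟩ := H i (by omega)
      have hpos : (0 : ℝ) < nseq ψ i := by exact_mod_cast nseq_pos hadm (by omega)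
      rw [ratio_eq hadm (by omega)]
      apply ENNReal.ofReal_le_ofReal
      rw [div_le_iff₀ hpos]
      have h3 : (nseq ψ (i + 1) : ℝ) + nseq ψ j = 2 * nseq ψ i := by
        exact_mod_cast nseq_inr hadm hj
      have h4 : nseq ψ i ≤ 3 ^ B * nseq ψ j :=
        (nseq_le hadm hB).trans (nseq_add_le hadm (by omega) B)
      have h5 : (nseq ψ i : ℝ) ≤ 3 ^ B * nseq ψ j := by exact_mod_cast h4
      have h6 : 1 / 3 ^ B * (nseq ψ i : ℝ) ≤ nseq ψ j := by
        rw [one_div, inv_mul_le_iff₀ (by positivity)]; exact h5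
      linarith
    refine hle.trans_lt ?_
    rw [show (2 : ENNReal) = ENNReal.ofReal 2 by simp]
    rw [ENNReal.ofReal_lt_ofReal_iff (by norm_num)]
    have : (0 : ℝ) < 1 / 3 ^ B := by positivity
    linarith
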